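/- arXiv:2605.05133 — 5 statements merged into one kernel-verified Lean document; each statement's English description precedes it below -/
import Mathlib

section
/- Let E be a real normed vector space, let 0 ≤ α < 1, and for l = 1, …, L let h_l : E → E be α-Lipschitz maps. Define the residual layers g_l(x) = x + h_l(x) and the composition g = g_L ∘ g_{L-1} ∘ ⋯ ∘ g_1. Then for all x, x' ∈ E: (1 - α)^L ‖x - x'‖ ≤ ‖g(x) - g(x')‖ ≤ (1 + α)^L ‖x - x'‖; in particular g is bi-Lipschitz with bounded distortion. -/
/-- One residual layer built from an `α`-Lipschitz map distorts distances by a factor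
between `1 - α` and `1 + α`. -/
theorem residual_layer_bilipschitz {E : Type*} [SeminormedAddCommGroup E] {α : ℝ} {h : E → E}
    (hLip : ∀ x x' : E, ‖h x - h x'‖ ≤ α * ‖x - x'‖) (x x' : E) :
    (1 - α) * ‖x - x'‖ ≤ ‖(x + h x) - (x' + h x')‖ ∧
      ‖(x + h x) - (x' + h x')‖ ≤ (1 + α) * ‖x - x'‖ := by
  rw [add_sub_add_comm]
  have hh := hLip x x'
  have hlow := norm_sub_le_norm_add (x - x') (h x - h x')
  have hupp := norm_add_le (x - x') (h x - h x')
  constructor <;> linarith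

/-- **An `L`-layer residual network is bi-Lipschitz with bounded distortion.**
If each `h l : E → E` is `α`-Lipschitz with `0 ≤ α < 1`, and `g k` denotes the
composition of the first `k` residual layers `x ↦ x + h l x` (so `g L = g_L ∘ ⋯ ∘ g_1`),
then `(1 - α)^L * ‖x - x'‖ ≤ ‖g L x - g L x'‖ ≤ (1 + α)^L * ‖x - x'‖`. -/
theorem residual_network_bilipschitz {E : Type*} [NormedAddCommGroup E] [NormedSpace ℝ E]
    (α : ℝ) (hα0 : 0 ≤ α) (hα1 : α < 1) (L : ℕ) (h : Fin L → E → E)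
    (hLip : ∀ l : Fin L, ∀ x x' : E, ‖h l x - h l x'‖ ≤ α * ‖x - x'‖)
    (g : ℕ → E → E) (hg0 : g 0 = id)
    (hgs : ∀ l : Fin L, g (l + 1) = (fun x => x + h l x) ∘ g l) :
    ∀ x x' : E,
      (1 - α) ^ L * ‖x - x'‖ ≤ ‖g L x - g L x'‖ ∧
        ‖g L x - g L x'‖ ≤ (1 + α) ^ L * ‖x - x'‖ := by
  intro x x'
  suffices key : ∀ k ≤ L, (1 - α) ^ k * ‖x - x'‖ ≤ ‖g k x - g k x'‖ ∧
      ‖g k x - g k x'‖ ≤ (1 + α) ^ k * ‖x - x'‖ from key L le_rfl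
  intro k
  induction k with
  | zero => simp [hg0]
  | succ k ih =>
    intro hk
    obtain ⟨ihl, ihu⟩ := ih (Nat.le_of_succ_le hk)
    obtain ⟨hl, hu⟩ := residual_layer_bilipschitz (hLip ⟨k, hk⟩) (g k x) (g k x')
    have hg : g (k + 1) = (fun x => x + h ⟨k, hk⟩ x) ∘ g k := hgs ⟨k, hk⟩
    simp only [hg, Function.comp_apply, pow_succ', mul_assoc]
    exact ⟨(mul_le_mul_of_nonneg_left ihl (by linarith)).trans hl,
      hu.trans (mul_le_mul_of_nonneg_left ihu (by linarith))⟩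
end

section
/- Let c ≥ 0 and for l = 1, …, L let W_l be real n × n matrices whose ℓ²-operator norms (spectral norms, as linear maps from Euclidean ℝⁿ to Euclidean ℝⁿ) satisfy ‖W_l‖₂ ≤ c, let b_l ∈ ℝⁿ, and let φ_l : ℝⁿ → ℝⁿ be 1-Lipschitz with respect to the Euclidean norm. Define the residual layers g_l(x) = x + φ_l(W_l x + b_l) and the network g = g_L ∘ ⋯ ∘ g_1. Then g is Lipschitz with constant (1 + c)^L; moreover, if c < 1 then additionally (1 - c)^L ‖x - x'‖ ≤ ‖g(x) - g(x')‖ for all x, x' ∈ ℝⁿ. -/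
open scoped Matrix

/-- A perturbation of the identity by a map that is `c`-Lipschitz between two given points
changes their distance by a factor between `1 - c` and `1 + c`. -/
lemma norm_add_sub_add_bounds {E : Type*} [SeminormedAddCommGroup E] {c : ℝ} {x x' u u' : E}
    (h : ‖u - u'‖ ≤ c * ‖x - x'‖) :
    (1 - c) * ‖x - x'‖ ≤ ‖(x + u) - (x' + u')‖ ∧
      ‖(x + u) - (x' + u')‖ ≤ (1 + c) * ‖x - x'‖ := by
  rw [add_sub_add_comm]
  have h₁ := norm_add_le (x - x') (u - u')
  have h₂ := norm_sub_le_norm_add (x - x') (u - u')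
  constructor <;> linarith

/-- **Spectrally normalised residual networks are Lipschitz (and bi-Lipschitz when `c < 1`).**
Let `W l` be real `n × n` matrices with spectral norm (ℓ²-operator norm as maps between
Euclidean spaces) at most `c`, `b l ∈ ℝⁿ`, and `φ l` be `1`-Lipschitz maps. If `g k` denotes
the composition of the first `k` residual layers `x ↦ x + φ l (W l x + b l)`, then `g L` is
Lipschitz with constant `(1 + c)^L`, and moreover if `c < 1` then
`(1 - c)^L * ‖x - x'‖ ≤ ‖g L x - g L x'‖` for all `x, x'`. -/
theorem spectral_norm_residual_network_lipschitz {n : ℕ} (c : ℝ) (hc : 0 ≤ c) (L : ℕ)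
    (W : Fin L → Matrix (Fin n) (Fin n) ℝ)
    (hW : ∀ l : Fin L, ‖Matrix.toEuclideanCLM (𝕜 := ℝ) (W l)‖ ≤ c)
    (b : Fin L → EuclideanSpace ℝ (Fin n))
    (φ : Fin L → EuclideanSpace ℝ (Fin n) → EuclideanSpace ℝ (Fin n))
    (hφ : ∀ l : Fin L, ∀ x x' : EuclideanSpace ℝ (Fin n), ‖φ l x - φ l x'‖ ≤ ‖x - x'‖)
    (g : ℕ → EuclideanSpace ℝ (Fin n) → EuclideanSpace ℝ (Fin n))
    (hg0 : g 0 = id)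
    (hgs : ∀ l : Fin L,
      g (l + 1) = fun x => g l x + φ l (Matrix.toEuclideanCLM (𝕜 := ℝ) (W l) (g l x) + b l)) :
    (∀ x x' : EuclideanSpace ℝ (Fin n), ‖g L x - g L x'‖ ≤ (1 + c) ^ L * ‖x - x'‖) ∧
      (c < 1 → ∀ x x' : EuclideanSpace ℝ (Fin n),
        (1 - c) ^ L * ‖x - x'‖ ≤ ‖g L x - g L x'‖) := by
  have layer (l : Fin L) (x x' : EuclideanSpace ℝ (Fin n)) :
      (1 - c) * ‖g l x - g l x'‖ ≤ ‖g (l + 1) x - g (l + 1) x'‖ ∧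
        ‖g (l + 1) x - g (l + 1) x'‖ ≤ (1 + c) * ‖g l x - g l x'‖ := by
    rw [hgs l]
    refine norm_add_sub_add_bounds ((hφ l _ _).trans ?_)
    rw [add_sub_add_right_eq_sub, ← map_sub]
    exact ContinuousLinearMap.le_of_opNorm_le _ (hW l) _
  have upper (k : ℕ) (hk : k ≤ L) (x x' : EuclideanSpace ℝ (Fin n)) :
      ‖g k x - g k x'‖ ≤ (1 + c) ^ k * ‖x - x'‖ := by
    induction k with
    | zero => simp [hg0]
    | succ k ih =>
      calc ‖g (k + 1) x - g (k + 1) x'‖ ≤ (1 + c) * ‖g k x - g k x'‖ := (layer ⟨k, hk⟩ x x').2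
        _ ≤ (1 + c) * ((1 + c) ^ k * ‖x - x'‖) := by gcongr; exact ih (Nat.le_of_succ_le hk)
        _ = (1 + c) ^ (k + 1) * ‖x - x'‖ := by ring
  have lower (hc1 : c < 1) (k : ℕ) (hk : k ≤ L) (x x' : EuclideanSpace ℝ (Fin n)) :
      (1 - c) ^ k * ‖x - x'‖ ≤ ‖g k x - g k x'‖ := by
    induction k with
    | zero => simp [hg0]
    | succ k ih =>
      calc (1 - c) ^ (k + 1) * ‖x - x'‖ = (1 - c) * ((1 - c) ^ k * ‖x - x'‖) := by ring
        _ ≤ (1 - c) * ‖g k x - g k x'‖ :=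
          mul_le_mul_of_nonneg_left (ih (Nat.le_of_succ_le hk)) (sub_nonneg.2 hc1.le)
        _ ≤ ‖g (k + 1) x - g (k + 1) x'‖ := (layer ⟨k, hk⟩ x x').1
  exact ⟨upper L le_rfl, fun hc1 => lower hc1 L le_rfl⟩
end

section
/- Let I be a finite index set and for each i ∈ I let μ_i and ν_i be probability measures on a measurable space X_i. Then the Kullback–Leibler divergence between the product measures factorises as a sum: KL(⊗_{i∈I} μ_i ‖ ⊗_{i∈I} ν_i) = Σ_{i∈I} KL(μ_i ‖ ν_i). -/
open MeasureTheory
open scoped Classical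

/-- The Kullback–Leibler divergence `KL(μ ‖ ν)`: equal to `∫ log (dμ/dν) dμ` when `μ` is
absolutely continuous with respect to `ν` (and the log-likelihood ratio is integrable),
and `+∞` otherwise. -/
noncomputable def klDiv {X : Type*} [MeasurableSpace X] (μ ν : Measure X) : EReal :=
  if μ ≪ ν ∧ Integrable (llr μ ν) μ then ((∫ x, llr μ ν x ∂μ : ℝ) : EReal) else ⊤

namespace InformationTheory

section

variable {𝓧 𝓨 : Type*} [MeasurableSpace 𝓧] [MeasurableSpace 𝓨]

lemma klDiv_map_measurableEquiv (μ ν : Measure 𝓧) [IsFiniteMeasure μ] [IsFiniteMeasure ν]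
    (e : 𝓧 ≃ᵐ 𝓨) : klDiv (μ.map e) (ν.map e) = klDiv μ ν := by
  refine le_antisymm (klDiv_map_le μ ν e.measurable) ?_
  simpa using klDiv_map_le (μ.map e) (ν.map e) e.symm.measurable

lemma klDiv_prod (μ ν : Measure 𝓧) (μ' ν' : Measure 𝓨) [IsProbabilityMeasure μ]
    [IsProbabilityMeasure ν] [IsProbabilityMeasure μ'] [IsProbabilityMeasure ν'] :
    klDiv (μ.prod μ') (ν.prod ν') = klDiv μ ν + klDiv μ' ν' := by
  have h_left : klDiv (μ.prod μ') (μ.prod ν') = klDiv μ' ν' := by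
    rw [← Measure.prod_swap (μ := μ') (ν := μ), ← Measure.prod_swap (μ := ν') (ν := μ)]
    refine (klDiv_map_measurableEquiv _ _ MeasurableEquiv.prodComm).trans ?_
    simpa using klDiv_compProd_left μ' ν' (ProbabilityTheory.Kernel.const 𝓨 μ)
  simpa [h_left] using klDiv_compProd_eq_add μ ν (ProbabilityTheory.Kernel.const 𝓧 μ')
    (ProbabilityTheory.Kernel.const 𝓧 ν')

end

lemma klDiv_pi_fin {n : ℕ} {X : Fin n → Type*} [∀ i, MeasurableSpace (X i)]
    (μ ν : ∀ i, Measure (X i)) [∀ i, IsProbabilityMeasure (μ i)]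
    [∀ i, IsProbabilityMeasure (ν i)] :
    klDiv (Measure.pi μ) (Measure.pi ν) = ∑ i, klDiv (μ i) (ν i) := by
  induction n with
  | zero => rw [Measure.pi_of_empty μ, Measure.pi_of_empty ν, klDiv_self, Fin.sum_univ_zero]
  | succ n ih =>
    rw [← klDiv_map_measurableEquiv _ _ (MeasurableEquiv.piFinSuccAbove X 0),
      (measurePreserving_piFinSuccAbove μ 0).map_eq, (measurePreserving_piFinSuccAbove ν 0).map_eq,
      klDiv_prod, ih, Fin.sum_univ_succ]
    rfl

/-- The Kullback-Leibler divergence between finite products of probability measures is the sum of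
the divergences between the factors. -/
theorem klDiv_pi {ι : Type*} [Fintype ι] {X : ι → Type*} [∀ i, MeasurableSpace (X i)]
    (μ ν : ∀ i, Measure (X i)) [∀ i, IsProbabilityMeasure (μ i)]
    [∀ i, IsProbabilityMeasure (ν i)] :
    klDiv (Measure.pi μ) (Measure.pi ν) = ∑ i, klDiv (μ i) (ν i) := by
  let e := (Fintype.equivFin ι).symm
  rw [← Measure.pi_map_piCongrLeft e μ, ← Measure.pi_map_piCongrLeft e ν,
    klDiv_map_measurableEquiv, klDiv_pi_fin, e.sum_comp fun i ↦ klDiv (μ i) (ν i)]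

end InformationTheory

/-- On probability measures, the `EReal`-valued divergence is the coercion of the
`ENNReal`-valued `InformationTheory.klDiv`. -/
lemma klDiv_eq_coe_klDiv {X : Type*} [MeasurableSpace X] (μ ν : Measure X)
    [IsProbabilityMeasure μ] [IsProbabilityMeasure ν] :
    klDiv μ ν = (InformationTheory.klDiv μ ν : EReal) := by
  by_cases h : μ ≪ ν ∧ Integrable (llr μ ν) μ
  · have h_nonneg := InformationTheory.integral_llr_add_sub_measure_univ_nonneg h.1 h.2
    rw [klDiv, if_pos h, InformationTheory.klDiv_of_ac_of_integrable h.1 h.2,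
      EReal.coe_ennreal_ofReal, max_eq_left h_nonneg]
    simp
  · rw [klDiv, if_neg h, not_not.mp (mt InformationTheory.klDiv_ne_top_iff.mp h),
      EReal.coe_ennreal_top]

/-- **KL divergence of finite products factorises as a sum.**
For a finite index set `ι` and probability measures `μ i`, `ν i` on measurable spaces `X i`,
`KL(⊗ᵢ μᵢ ‖ ⊗ᵢ νᵢ) = Σᵢ KL(μᵢ ‖ νᵢ)`. -/
theorem klDiv_pi_eq_sum {ι : Type*} [Fintype ι] {X : ι → Type*}
    [∀ i, MeasurableSpace (X i)] (μ ν : ∀ i, Measure (X i))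
    [∀ i, IsProbabilityMeasure (μ i)] [∀ i, IsProbabilityMeasure (ν i)] :
    klDiv (Measure.pi μ) (Measure.pi ν) = ∑ i, klDiv (μ i) (ν i) := by
  simp_rw [klDiv_eq_coe_klDiv, InformationTheory.klDiv_pi]
  exact map_sum (⟨⟨((↑) : ENNReal → EReal), EReal.coe_ennreal_zero⟩, EReal.coe_ennreal_add⟩ :
    ENNReal →+ EReal) _ _
end

section
/- Let U be a real P × L matrix with orthonormal columns (UᵀU = I_L), let s₁, …, s_L > 0, let S = diag(s₁, …, s_L), H = U·S^{1/2} where S^{1/2} = diag(√s₁, …, √s_L), and let Σ = σ²·I_P with σ > 0. Then HᵀΣ⁻¹H = σ⁻²·S (in particular it is invertible), the projection matrix T := (HᵀΣ⁻¹H)⁻¹HᵀΣ⁻¹ equals S^{-1/2}·Uᵀ, and the projected noise Σ_T := (HᵀΣ⁻¹H)⁻¹ equals σ²·S⁻¹ (which is diagonal). -/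
open scoped Matrix

/-- **The OILMM projection and projected noise.**
Let `U` be a real `P × L` matrix with orthonormal columns (`Uᵀ U = I`), `S = diag s` with
`s l > 0`, `H = U S^{1/2}` and `Σ = σ² I`. Then `Hᵀ Σ⁻¹ H = σ⁻² S` (in particular it is
invertible), the projection `T = (Hᵀ Σ⁻¹ H)⁻¹ Hᵀ Σ⁻¹` equals `S^{-1/2} Uᵀ`, and the projected
noise `Σ_T = (Hᵀ Σ⁻¹ H)⁻¹` equals `σ² S⁻¹` (a diagonal matrix). -/
theorem oilmm_projection_and_projected_noise {P L : ℕ}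
    (U : Matrix (Fin P) (Fin L) ℝ) (hU : Uᵀ * U = 1)
    (s : Fin L → ℝ) (hs : ∀ l, 0 < s l) (σ : ℝ) (hσ : 0 < σ) :
    let Shalf : Matrix (Fin L) (Fin L) ℝ := Matrix.diagonal fun l => Real.sqrt (s l)
    let H : Matrix (Fin P) (Fin L) ℝ := U * Shalf
    let Sig : Matrix (Fin P) (Fin P) ℝ := (σ ^ 2) • (1 : Matrix (Fin P) (Fin P) ℝ)
    (Hᵀ * Sig⁻¹ * H = (σ ^ 2)⁻¹ • Matrix.diagonal s) ∧
      IsUnit (Hᵀ * Sig⁻¹ * H) ∧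
      (Hᵀ * Sig⁻¹ * H)⁻¹ * Hᵀ * Sig⁻¹ =
        (Matrix.diagonal fun l => (Real.sqrt (s l))⁻¹) * Uᵀ ∧
      (Hᵀ * Sig⁻¹ * H)⁻¹ = (σ ^ 2) • (Matrix.diagonal s)⁻¹ := by
  intro Shalf H Sig
  have hσ2 : σ ^ 2 ≠ 0 := (pow_pos hσ 2).ne'
  have hSig : Sig⁻¹ = (σ ^ 2)⁻¹ • (1 : Matrix (Fin P) (Fin P) ℝ) :=
    Matrix.inv_eq_right_inv (by simp [Sig, smul_smul, hσ2])
  have hHt : Hᵀ = Shalf * Uᵀ := by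
    simp [H, Shalf, Matrix.transpose_mul, Matrix.diagonal_transpose]
  have hSS : Shalf * Shalf = Matrix.diagonal s := by
    simp only [Shalf, Matrix.diagonal_mul_diagonal, Real.mul_self_sqrt (hs _).le]
  have hgram : Hᵀ * Sig⁻¹ * H = (σ ^ 2)⁻¹ • Matrix.diagonal s := by
    rw [hSig, Matrix.mul_smul, Matrix.mul_one, Matrix.smul_mul, hHt, Matrix.mul_assoc,
      ← Matrix.mul_assoc Uᵀ U Shalf, hU, Matrix.one_mul, hSS]
  have hdiag : Matrix.diagonal s * Matrix.diagonal (fun l => (s l)⁻¹) = 1 := by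
    simp only [Matrix.diagonal_mul_diagonal, mul_inv_cancel₀ (hs _).ne', Matrix.diagonal_one]
  have hdinv : (Matrix.diagonal s)⁻¹ = Matrix.diagonal (fun l => (s l)⁻¹) :=
    Matrix.inv_eq_right_inv hdiag
  have hmul : ((σ ^ 2)⁻¹ • Matrix.diagonal s) * ((σ ^ 2) • (Matrix.diagonal s)⁻¹) = 1 := by
    rw [hdinv, Matrix.smul_mul, Matrix.mul_smul, hdiag, smul_smul, inv_mul_cancel₀ hσ2, one_smul]
  have hinv : (Hᵀ * Sig⁻¹ * H)⁻¹ = (σ ^ 2) • (Matrix.diagonal s)⁻¹ := by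
    rw [hgram]
    exact Matrix.inv_eq_right_inv hmul
  have hsqrt : Matrix.diagonal (fun l => (s l)⁻¹) * Shalf =
      Matrix.diagonal fun l => (Real.sqrt (s l))⁻¹ := by
    rw [Matrix.diagonal_mul_diagonal]
    congr 1
    funext l
    rw [inv_mul_eq_div, Real.sqrt_div_self', one_div]
  refine ⟨hgram, ?_, ?_, hinv⟩
  · rw [hgram]
    exact IsUnit.of_mul_eq_one _ hmul
  · rw [hinv, hdinv, hHt, hSig, Matrix.mul_smul, Matrix.mul_one, Matrix.smul_mul, smul_smul,
      inv_mul_cancel₀ hσ2, one_smul, ← Matrix.mul_assoc, hsqrt]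
end

section
/- Let Σ be a real symmetric positive definite P × P matrix and H a real P × L matrix such that HᵀΣ⁻¹H is positive definite (hence invertible), and set T = (HᵀΣ⁻¹H)⁻¹HᵀΣ⁻¹ and Σ_T = (HᵀΣ⁻¹H)⁻¹. For a positive definite k × k matrix A, write ℓ_A(v) = -(k/2)·log(2π) - ½·log det A - ½·vᵀA⁻¹v for the log-density of the centered Gaussian with covariance A at v. Then for every y ∈ ℝᴾ: ℓ_Σ(y) - ℓ_{Σ_T}(T y) = -((P - L)/2)·log(2π) - ½·log(det Σ / det Σ_T) - ½·(y - H T y)ᵀ Σ⁻¹ (y - H T y). -/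
open scoped Matrix

/-- Pythagoras for weighted least squares: a solution `t` of the normal equations splits the
quadratic form `yᵀ W y` into a residual part and a fitted part. -/
theorem Matrix.IsSymm.dotProduct_mulVec_residual {m n R : Type*} [Fintype m] [Fintype n]
    [CommRing R] {W : Matrix m m R} (hW : W.IsSymm) (H : Matrix m n R) {y : m → R} {t : n → R}
    (ht : (Hᵀ * W * H) *ᵥ t = (Hᵀ * W) *ᵥ y) :
    (y - H *ᵥ t) ⬝ᵥ W *ᵥ (y - H *ᵥ t) = y ⬝ᵥ W *ᵥ y - t ⬝ᵥ (Hᵀ * W * H) *ᵥ t := by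
  have h_transpose (v : m → R) : H *ᵥ t ⬝ᵥ v = t ⬝ᵥ Hᵀ *ᵥ v := by
    rw [Matrix.dotProduct_mulVec, Matrix.vecMul_transpose]
  have h_cross : H *ᵥ t ⬝ᵥ W *ᵥ y = t ⬝ᵥ (Hᵀ * W * H) *ᵥ t := by
    rw [h_transpose, Matrix.mulVec_mulVec, ht]
  have h_fit : H *ᵥ t ⬝ᵥ W *ᵥ (H *ᵥ t) = t ⬝ᵥ (Hᵀ * W * H) *ᵥ t := by
    rw [h_transpose, Matrix.mulVec_mulVec, Matrix.mulVec_mulVec]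
  have h_symm : y ⬝ᵥ W *ᵥ (H *ᵥ t) = H *ᵥ t ⬝ᵥ W *ᵥ y := by
    rw [Matrix.dotProduct_mulVec, ← Matrix.mulVec_transpose, hW.eq, dotProduct_comm]
  rw [Matrix.mulVec_sub, dotProduct_sub, sub_dotProduct, sub_dotProduct, h_symm, h_cross, h_fit]
  ring

/-- **The ILMM log-likelihood correction term.**
Let `Σ` be a real symmetric positive definite `P × P` matrix and `H` a real `P × L` matrix
with `Hᵀ Σ⁻¹ H` positive definite, `T = (Hᵀ Σ⁻¹ H)⁻¹ Hᵀ Σ⁻¹` and `Σ_T = (Hᵀ Σ⁻¹ H)⁻¹`.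
Writing `ℓ_A(v) = -(k/2) log(2π) - ½ log det A - ½ vᵀ A⁻¹ v` for the centered Gaussian
log-density with covariance `A` (of size `k`), for every `y ∈ ℝᴾ`:
`ℓ_Σ(y) - ℓ_{Σ_T}(T y)
  = -((P - L)/2) log(2π) - ½ log (det Σ / det Σ_T) - ½ (y - H T y)ᵀ Σ⁻¹ (y - H T y)`. -/
theorem ilmm_log_density_correction {P L : ℕ}
    (Sig : Matrix (Fin P) (Fin P) ℝ) (hSig : Sig.PosDef)
    (H : Matrix (Fin P) (Fin L) ℝ) (hH : (Hᵀ * Sig⁻¹ * H).PosDef) :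
    let T : Matrix (Fin L) (Fin P) ℝ := (Hᵀ * Sig⁻¹ * H)⁻¹ * Hᵀ * Sig⁻¹
    let SigT : Matrix (Fin L) (Fin L) ℝ := (Hᵀ * Sig⁻¹ * H)⁻¹
    ∀ y : Fin P → ℝ,
      (-((P : ℝ) / 2) * Real.log (2 * Real.pi) - (1 / 2) * Real.log Sig.det -
            (1 / 2) * (y ⬝ᵥ Sig⁻¹.mulVec y)) -
          (-((L : ℝ) / 2) * Real.log (2 * Real.pi) - (1 / 2) * Real.log SigT.det -
            (1 / 2) * (T.mulVec y ⬝ᵥ SigT⁻¹.mulVec (T.mulVec y))) =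
        -(((P : ℝ) - (L : ℝ)) / 2) * Real.log (2 * Real.pi) -
          (1 / 2) * Real.log (Sig.det / SigT.det) -
          (1 / 2) *
            ((y - H.mulVec (T.mulVec y)) ⬝ᵥ Sig⁻¹.mulVec (y - H.mulVec (T.mulVec y))) := by
  intro T SigT y
  have hG : IsUnit (Hᵀ * Sig⁻¹ * H).det := hH.det_pos.ne'.isUnit
  have hSigT : SigT⁻¹ = Hᵀ * Sig⁻¹ * H := Matrix.nonsing_inv_nonsing_inv _ hG
  have hW : (Sig⁻¹).IsSymm := by
    simpa [Matrix.IsSymm, Matrix.IsHermitian, Matrix.conjTranspose_eq_transpose_of_trivial]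
      using hSig.inv.isHermitian
  have ht : (Hᵀ * Sig⁻¹ * H) *ᵥ (T *ᵥ y) = (Hᵀ * Sig⁻¹) *ᵥ y := by
    rw [Matrix.mulVec_mulVec]
    simp only [T]
    rw [Matrix.mul_assoc _ Hᵀ, Matrix.mul_nonsing_inv_cancel_left _ _ hG]
  rw [hW.dotProduct_mulVec_residual H ht, hSigT,
    Real.log_div hSig.det_pos.ne' hH.inv.det_pos.ne']
  ring
end
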